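/- arXiv:1712.07341 — 4 statements merged into one kernel-verified Lean document; each statement's English description precedes it below -/
import Mathlib

section
/- Let k be a perfect field, A a noetherian commutative k-algebra, and x ∈ A a non-zero-divisor such that A is complete with respect to the (x)-adic topology and the quotient ring A/(x) is a field which is a finite extension of k. Then there exists exactly one k-algebra homomorphism φ : A/(x) → A which is a section of the canonical projection π : A → A/(x), i.e. π ∘ φ = id. -/
/-- A finite algebra over a perfect field which is a field is formally étale. -/
theorem formallyEtale_of_isField {k L : Type*} [Field k] [PerfectField k] [CommRing L]
    [Algebra k L] [Module.Finite k L] (hL : IsField L) : Algebra.FormallyEtale k L := by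
  let := hL.toField
  exact Algebra.FormallyEtale.of_isSeparable k L

/-- If `A` is `I`-adically complete and `A ⧸ I` is formally étale over `R`, then the projection
`A → A ⧸ I` has exactly one `R`-algebra section. -/
theorem existsUnique_section_of_formallyEtale {R A : Type*} [CommRing R] [CommRing A] [Algebra R A]
    (I : Ideal A) [IsAdicComplete I A] [Algebra.FormallyEtale R (A ⧸ I)] :
    ∃! φ : (A ⧸ I) →ₐ[R] A, (Ideal.Quotient.mkₐ R I).comp φ = AlgHom.id R (A ⧸ I) := by
  obtain ⟨φ, hφ⟩ :=
    Algebra.FormallySmooth.exists_mkₐ_comp_eq_of_isAdicComplete (AlgHom.id R (A ⧸ I))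
  refine ⟨φ, hφ, fun ψ hψ ↦ ?_⟩
  have hI : ⨅ n, I ^ n = ⊥ := by
    simpa using IsHausdorff.iInf_pow_smul (I := I) (M := A) inferInstance
  exact Algebra.FormallyUnramified.ext_of_iInf I hI fun a ↦
    DFunLike.congr_fun (hψ.trans hφ.symm) a

/-- Let `k` be a perfect field, `A` a noetherian commutative `k`-algebra,
and `x ∈ A` a non-zero-divisor such that `A` is complete with respect to the `(x)`-adic
topology and the quotient ring `A/(x)` is a field which is a finite extension of `k`.
Then there exists exactly one `k`-algebra homomorphism `φ : A/(x) → A` which is a section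
of the canonical projection `π : A → A/(x)`, i.e. `π ∘ φ = id`. -/
theorem statement_0 {k : Type*} [Field k] [PerfectField k]
    {A : Type*} [CommRing A] [IsNoetherianRing A] [Algebra k A]
    (x : A) (hx : x ∈ nonZeroDivisors A)
    (hcomplete : IsAdicComplete (Ideal.span {x}) A)
    (hfield : IsField (A ⧸ Ideal.span {x}))
    (hfin : Module.Finite k (A ⧸ Ideal.span {x})) :
    ∃! φ : (A ⧸ Ideal.span {x}) →ₐ[k] A,
      (Ideal.Quotient.mkₐ k (Ideal.span {x})).comp φ
        = AlgHom.id k (A ⧸ Ideal.span {x}) := by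
  have := formallyEtale_of_isField (k := k) hfield
  exact existsUnique_section_of_formallyEtale (Ideal.span {x})
end

section
/- Let k be a field of characteristic 0, k' a finite extension of k, and K = k'((s)) the field of formal Laurent series over k'. Fix a, b ∈ K and let τ_{a,b} : K[t]/(t³) → K[t]/(t³) be the map defined on c₀ + c₁t + c₂t² (cᵢ ∈ K) by τ_{a,b}(c₀ + c₁t + c₂t²) = c₀ + (c₁ + c₀′a)t + (c₂ + c₁′a + c₀′b + ½c₀″a²)t², where ′ denotes the derivative d/ds on K. Then for every α₀ ∈ K^× and α₁, α₂ ∈ K one has, in K[t]/(t³): τ_{a,b}(α₀·exp(α₁t + α₂t²)) = α₀·exp( (α₁ + (α₀′/α₀)a)·t + (α₂ + α₁′a + (α₀′/α₀)b + (α₀″/(2α₀))a² − ½((α₀′/α₀)a)²)·t² ). -/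
noncomputable section

/-- The formal derivative `d/ds` on the field of Laurent series `k'((s))`. -/
def lsDeriv {k' : Type*} [Field k'] (f : LaurentSeries k') : LaurentSeries k' where
  coeff n := (n + 1 : ℤ) • f.coeff (n + 1)
  isPWO_support' := by
    refine Set.IsPWO.mono (Set.IsPWO.image_of_monotoneOn (f.isPWO_support)
      (fun x _ y _ h => by simpa using h : MonotoneOn (fun m : ℤ => m - 1) f.support)) ?_
    intro n hn
    refine ⟨n + 1, ?_, by ring⟩
    simp only [Function.mem_support, ne_eq] at hn ⊢
    intro h
    exact hn (by simp [HahnSeries.support, h] at hn ⊢)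

/-- The truncated polynomial ring `K[t]/(t³)`. -/
abbrev T3 (K : Type*) [Field K] := Polynomial K ⧸ Ideal.span {(Polynomial.X : Polynomial K) ^ 3}

/-- The class of `t` in `K[t]/(t³)`. -/
def tE (K : Type*) [Field K] : T3 K := Ideal.Quotient.mk _ Polynomial.X

/-- The constant `x` viewed in `K[t]/(t³)`. -/
def cE {K : Type*} [Field K] (x : K) : T3 K := algebraMap K (T3 K) x

/-- The truncated exponential `exp(u) = 1 + u + u²/2` on `K[t]/(t³)`, well defined in
characteristic zero for `u` in the ideal `(t)`. -/
def expE {K : Type*} [Field K] (u : T3 K) : T3 K := 1 + u + cE (2⁻¹ : K) * u ^ 2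

/-- The element `α₀ · exp(α₁ t + α₂ t²)` of `K[t]/(t³)`. -/
def unitE {K : Type*} [Field K] (α₀ α₁ α₂ : K) : T3 K :=
  cE α₀ * expE (cE α₁ * tE K + cE α₂ * tE K ^ 2)

/-- The map `τ_{a,b}` of `K[t]/(t³)`, described by its value on the element
`c₀ + c₁ t + c₂ t²`, where `D` is the derivative `d/ds` of `K = k'((s))`:
`τ_{a,b}(c₀ + c₁t + c₂t²) = c₀ + (c₁ + c₀′a)t + (c₂ + c₁′a + c₀′b + ½c₀″a²)t²`. -/
def tauE {K : Type*} [Field K] (D : K → K) (a b c0 c1 c2 : K) : T3 K :=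
  cE c0 + cE (c1 + D c0 * a) * tE K
    + cE (c2 + D c1 * a + D c0 * b + (2⁻¹ : K) * D (D c0) * a ^ 2) * tE K ^ 2

/-- The Euler operator `s · d/ds` on Laurent series. -/
def lsEuler {F : Type*} [Field F] (f : LaurentSeries F) : LaurentSeries F where
  coeff n := n • f.coeff n
  isPWO_support' := f.isPWO_support.mono fun n hn h => hn (by simp [h])

theorem support_lsEuler_subset {F : Type*} [Field F] (f : LaurentSeries F) :
    (lsEuler f).support ⊆ f.support :=
  fun n hn h => hn (by simp [lsEuler, h])

theorem lsEuler_mul {F : Type*} [Field F] (f g : LaurentSeries F) :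
    lsEuler (f * g) = lsEuler f * g + f * lsEuler g := by
  ext n
  rw [HahnSeries.coeff_add, HahnSeries.coeff_mul_left' f.isPWO_support (support_lsEuler_subset f),
    HahnSeries.coeff_mul_right' g.isPWO_support (support_lsEuler_subset g),
    ← Finset.sum_add_distrib]
  simp only [lsEuler, HahnSeries.coeff_mul, Finset.smul_sum]
  refine Finset.sum_congr rfl fun ij hij => ?_
  rw [Finset.mem_antidiagonal] at hij
  rw [← hij.2.2, add_smul, smul_mul_assoc, mul_smul_comm]

theorem lsDeriv_eq_single_mul_lsEuler {F : Type*} [Field F] (f : LaurentSeries F) :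
    lsDeriv f = HahnSeries.single (-1) 1 * lsEuler f := by
  ext n
  simp [HahnSeries.coeff_single_mul, lsDeriv, lsEuler]

/-- The Leibniz rule for the derivative of Laurent series. -/
theorem lsDeriv_mul {F : Type*} [Field F] (f g : LaurentSeries F) :
    lsDeriv (f * g) = lsDeriv f * g + f * lsDeriv g := by
  simp only [lsDeriv_eq_single_mul_lsEuler, lsEuler_mul]
  ring

theorem tE_pow_three (K : Type*) [Field K] : tE K ^ 3 = 0 := by
  rw [tE, ← map_pow, Ideal.Quotient.eq_zero_iff_mem]
  exact Ideal.mem_span_singleton_self _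

/-- The elements `1, t, t²` of `K[t]/(t³)` are linearly independent over `K`. -/
theorem cE_add_cE_mul_tE_inj {K : Type*} [Field K] {c₀ c₁ c₂ d₀ d₁ d₂ : K}
    (h : cE c₀ + cE c₁ * tE K + cE c₂ * tE K ^ 2 = cE d₀ + cE d₁ * tE K + cE d₂ * tE K ^ 2) :
    c₀ = d₀ ∧ c₁ = d₁ ∧ c₂ = d₂ := by
  have hmk (x y z : K) : cE x + cE y * tE K + cE z * tE K ^ 2 =
      Ideal.Quotient.mk (Ideal.span {(Polynomial.X : Polynomial K) ^ 3})
        (Polynomial.C x + Polynomial.C y * Polynomial.X + Polynomial.C z * Polynomial.X ^ 2) := by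
    simp only [map_add, map_mul, map_pow]
    rfl
  rw [hmk, hmk, Ideal.Quotient.eq, Ideal.mem_span_singleton, Polynomial.X_pow_dvd_iff] at h
  have h₀ := h 0 (by norm_num)
  have h₁ := h 1 (by norm_num)
  have h₂ := h 2 (by norm_num)
  simp only [Polynomial.coeff_sub, sub_eq_zero] at h₀ h₁ h₂
  exact ⟨by simpa using h₀, by simpa [Polynomial.coeff_C] using h₁,
    by simpa [Polynomial.coeff_C, Polynomial.coeff_X] using h₂⟩

/-- The expansion of `α₀ · exp(α₁ t + α₂ t²)` in powers of `t`. -/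
theorem unitE_eq {K : Type*} [Field K] (α₀ α₁ α₂ : K) :
    unitE α₀ α₁ α₂ =
      cE α₀ + cE (α₀ * α₁) * tE K + cE (α₀ * (α₂ + 2⁻¹ * α₁ ^ 2)) * tE K ^ 2 := by
  have ht := tE_pow_three K
  simp only [unitE, expE, cE, map_add, map_mul, map_pow]
  linear_combination (algebraMap K (T3 K) α₀ * algebraMap K (T3 K) 2⁻¹ *
    (2 * algebraMap K (T3 K) α₁ * algebraMap K (T3 K) α₂ +
      algebraMap K (T3 K) α₂ ^ 2 * tE K)) * ht

/-- Let `k` be a field of characteristic `0`, `k'` a finite extension of `k`,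
and `K = k'((s))`.  Fix `a, b ∈ K` and let `τ_{a,b} : K[t]/(t³) → K[t]/(t³)` be given on
`c₀ + c₁t + c₂t²` by `τ_{a,b}(c₀ + c₁t + c₂t²) = c₀ + (c₁ + c₀′a)t + (c₂ + c₁′a + c₀′b +
½c₀″a²)t²`, where `′` is `d/ds`.  Then for every `α₀ ∈ K^×` and `α₁, α₂ ∈ K` one has, in
`K[t]/(t³)`:
`τ_{a,b}(α₀·exp(α₁t + α₂t²)) = α₀·exp((α₁ + (α₀′/α₀)a)t + (α₂ + α₁′a + (α₀′/α₀)b +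
(α₀″/(2α₀))a² − ½((α₀′/α₀)a)²)t²)`. -/
theorem statement_1 {k : Type*} [Field k] [CharZero k] {k' : Type*} [Field k']
    [Algebra k k'] [FiniteDimensional k k']
    (a b α₀ α₁ α₂ : LaurentSeries k') (hα₀ : α₀ ≠ 0)
    (c0 c1 c2 : LaurentSeries k')
    (hc : cE c0 + cE c1 * tE (LaurentSeries k') + cE c2 * tE (LaurentSeries k') ^ 2
        = unitE α₀ α₁ α₂) :
    tauE lsDeriv a b c0 c1 c2
      = unitE α₀ (α₁ + lsDeriv α₀ / α₀ * a)
          (α₂ + lsDeriv α₁ * a + lsDeriv α₀ / α₀ * b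
            + lsDeriv (lsDeriv α₀) / (2 * α₀) * a ^ 2
            - (2⁻¹ : LaurentSeries k') * (lsDeriv α₀ / α₀ * a) ^ 2) := by
  have : CharZero k' := charZero_of_injective_algebraMap (algebraMap k k').injective
  have : CharZero (LaurentSeries k') :=
    charZero_of_injective_algebraMap (algebraMap k' (LaurentSeries k')).injective
  rw [unitE_eq] at hc
  obtain ⟨rfl, rfl, rfl⟩ := cE_add_cE_mul_tE_inj hc
  rw [unitE_eq, tauE, lsDeriv_mul]
  congr 3
  · congr 1
    field_simp
  · field_simp
    ring

end
end

section
/- Let k be a field of characteristic 0, k' a finite extension of k, and K = k'((s)). For all a, b ∈ K and all pairs of triples p̃ = (ỹ₁, ỹ₂, ỹ₃), p̂ = (ŷ₁, ŷ₂, ŷ₃) of units of K[t]/(t³) with ỹᵢ ≡ ŷᵢ mod t² for i = 1, 2, 3, one has Ω(τ_{a,b}(p̃), τ_{a,b}(p̂)) = Ω(p̃, p̂), where τ_{a,b} is applied entrywise. (In other words, Ω is invariant under every continuous k[[t]]-algebra automorphism of K[[t]] that induces the identity modulo (t).) -/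
noncomputable section

/-- The canonical expression `Ω(p̃, p̂) ∈ K` of the paper (the canonical 1-form is
`Ω(p̃,p̂)·ds`), evaluated via the exponential parameters `(a0 i, a1 i, x2 i)` of the entries
of `p̃` and `(a0 i, a1 i, y2 i)` of the entries of `p̂` (congruent mod `t²`, so the parameters
`a0`, `a1` are shared); `D` is the derivative of `K`:
`Ω(p̃, p̂) = Σ_{σ∈S₃} sgn(σ)·a1(σ1)·(x2(σ3) − y2(σ3))·(D(a0(σ2))/a0(σ2))`. -/
def Omega {K : Type*} [Field K] (D : K → K) (a0 a1 x2 y2 : Fin 3 → K) : K :=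
  ∑ σ : Equiv.Perm (Fin 3),
    (Equiv.Perm.sign σ : ℤ) •
      (a1 (σ 0) * ((x2 (σ 2) - y2 (σ 2)) * (D (a0 (σ 1)) / a0 (σ 1))))

theorem T3_coeff_ext {K : Type*} [Field K] {a b c a' b' c' : K}
    (h : cE a + cE b * tE K + cE c * tE K ^ 2 = cE a' + cE b' * tE K + cE c' * tE K ^ 2) :
    a = a' ∧ b = b' ∧ c = c' := by
  have h' : (Ideal.Quotient.mk (Ideal.span {(Polynomial.X : Polynomial K) ^ 3})
        (Polynomial.C a + Polynomial.C b * Polynomial.X + Polynomial.C c * Polynomial.X ^ 2))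
      = Ideal.Quotient.mk _
        (Polynomial.C a' + Polynomial.C b' * Polynomial.X
          + Polynomial.C c' * Polynomial.X ^ 2) := by
    simp only [map_add, map_mul, map_pow]
    exact h
  rw [Ideal.Quotient.eq, Ideal.mem_span_singleton, Polynomial.X_pow_dvd_iff] at h'
  have e0 := h' 0 (by norm_num)
  have e1 := h' 1 (by norm_num)
  have e2 := h' 2 (by norm_num)
  simp [Polynomial.coeff_X, Polynomial.coeff_C, Polynomial.coeff_X_pow] at e0 e1 e2
  exact ⟨sub_eq_zero.mp e0, sub_eq_zero.mp e1, sub_eq_zero.mp e2⟩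

/-- `Ω` does not change when `α₁` is shifted by a multiple of the logarithmic derivative
of `α₀`. -/
theorem Omega_add_mul_logDeriv {K : Type*} [Field K] (D : K → K) (a : K)
    {a0 a1 a1' x2 y2 x2' y2' : Fin 3 → K} (h1 : ∀ i, a1' i = a1 i + D (a0 i) / a0 i * a)
    (h2 : ∀ i, x2' i - y2' i = x2 i - y2 i) :
    Omega D a0 a1' x2' y2' = Omega D a0 a1 x2 y2 := by
  simp only [Omega, h1, h2]
  have key (u v w : Fin 3 → K) :
      ∑ σ : Equiv.Perm (Fin 3), (Equiv.Perm.sign σ : ℤ) • (u (σ 0) * (w (σ 2) * v (σ 1)))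
        = Matrix.det !![u 0, v 0, w 0; u 1, v 1, w 1; u 2, v 2, w 2] := by
    rw [Matrix.det_apply]
    refine Finset.sum_congr rfl fun σ _ => ?_
    rw [Units.smul_def, Fin.prod_univ_three]
    congr 1
    generalize σ 0 = i, σ 1 = j, σ 2 = l
    fin_cases i <;> fin_cases j <;> fin_cases l <;> simp <;> ring
  rw [key (fun i => a1 i + D (a0 i) / a0 i * a) (fun i => D (a0 i) / a0 i)
    (fun i => x2 i - y2 i), key a1 (fun i => D (a0 i) / a0 i) (fun i => x2 i - y2 i)]
  simp [Matrix.det_fin_three]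
  ring

/-- Let `k` be a field of characteristic `0`, `k'` a finite extension of `k`,
and `K = k'((s))`.  For all `a, b ∈ K` and all pairs of triples `p̃ = (ỹ₁,ỹ₂,ỹ₃)`,
`p̂ = (ŷ₁,ŷ₂,ŷ₃)` of units of `K[t]/(t³)` with `ỹᵢ ≡ ŷᵢ mod t²` — encoded by the shared
exponential parameters `a0 i ∈ K^×`, `a1 i` and second-order parameters `ta2 i` (for `p̃`)
and `ha2 i` (for `p̂`), the entries being `tc0 i + tc1 i·t + tc2 i·t²` resp.
`hc0 i + hc1 i·t + hc2 i·t²` — one has `Ω(τ_{a,b}(p̃), τ_{a,b}(p̂)) = Ω(p̃, p̂)`, where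
`τ_{a,b}` is applied entrywise and the exponential parameters of the image triples are
`a0' i ∈ K^×`, `a1' i`, `ta2' i`, `ha2' i`.  In other words, `Ω` is invariant under every
continuous `k[[t]]`-algebra automorphism of `K[[t]]` inducing the identity modulo `(t)`. -/
theorem statement_2 {k : Type*} [Field k] [CharZero k] {k' : Type*} [Field k']
    [Algebra k k'] [FiniteDimensional k k']
    (a b : LaurentSeries k')
    (a0 a1 ta2 ha2 : Fin 3 → LaurentSeries k') (h0 : ∀ i, a0 i ≠ 0)
    (tc0 tc1 tc2 hc0 hc1 hc2 : Fin 3 → LaurentSeries k')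
    (htc : ∀ i, cE (tc0 i) + cE (tc1 i) * tE (LaurentSeries k')
        + cE (tc2 i) * tE (LaurentSeries k') ^ 2 = unitE (a0 i) (a1 i) (ta2 i))
    (hhc : ∀ i, cE (hc0 i) + cE (hc1 i) * tE (LaurentSeries k')
        + cE (hc2 i) * tE (LaurentSeries k') ^ 2 = unitE (a0 i) (a1 i) (ha2 i))
    (a0' a1' ta2' ha2' : Fin 3 → LaurentSeries k') (h0' : ∀ i, a0' i ≠ 0)
    (htau : ∀ i, tauE lsDeriv a b (tc0 i) (tc1 i) (tc2 i)
        = unitE (a0' i) (a1' i) (ta2' i))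
    (hhtau : ∀ i, tauE lsDeriv a b (hc0 i) (hc1 i) (hc2 i)
        = unitE (a0' i) (a1' i) (ha2' i)) :
    Omega lsDeriv a0' a1' ta2' ha2' = Omega lsDeriv a0 a1 ta2 ha2 := by
  have hc (i : Fin 3) := T3_coeff_ext ((htc i).trans (unitE_eq _ _ _))
  have hd (i : Fin 3) := T3_coeff_ext ((hhc i).trans (unitE_eq _ _ _))
  have hc' (i : Fin 3) := T3_coeff_ext ((htau i).trans (unitE_eq _ _ _))
  have hd' (i : Fin 3) := T3_coeff_ext ((hhtau i).trans (unitE_eq _ _ _))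
  obtain rfl : a0' = a0 := funext fun i => (hc' i).1.symm.trans (hc i).1
  refine Omega_add_mul_logDeriv lsDeriv a (fun i => ?_) (fun i => ?_)
  · have h := (hc' i).2.1
    rw [(hc i).1, (hc i).2.1] at h
    have := h0 i
    field_simp
    linear_combination -h
  · have h := (hc' i).2.2
    have g := (hd' i).2.2
    rw [(hc i).1, (hc i).2.1, (hc i).2.2] at h
    rw [(hd i).1, (hd i).2.1, (hd i).2.2] at g
    refine mul_left_cancel₀ (h0 i) ?_
    linear_combination g - h

end
end

section
/- Let k be a field of characteristic 0, k' a finite extension of k, and K = k'((s)). Let f̃, f̂ be units of K[t]/(t³) such that 1 − f̃ and 1 − f̂ are also units and f̃ ≡ f̂ mod t², and let g̃, ĝ be units of K[t]/(t³) with g̃ ≡ ĝ mod t². Then Ω((1 − f̃, f̃, g̃), (1 − f̂, f̂, ĝ)) = 0. (Consequently, the canonical 1-form ω vanishes on the image of the relative Bloch complex map Δ : B₂(B, (t²)) ⊗ β(B, (t²)) → Λ³β(B, (t²)) for B = K[[t]].) -/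
noncomputable section

open Polynomial in
/-- Multiplied out, `α₀ · exp(α₁ t + α₂ t²)` is `α₀ + α₀α₁ t + α₀(α₂ + α₁²/2) t²`. -/
theorem unitE_eq_mk {K : Type*} [Field K] (a b c : K) :
    unitE a b c = Ideal.Quotient.mk (Ideal.span {(X : K[X]) ^ 3})
      (C a + C (a * b) * X + C (a * (c + 2⁻¹ * b ^ 2)) * X ^ 2) := by
  have hC (x : K) : cE x = Ideal.Quotient.mk (Ideal.span {(X : K[X]) ^ 3}) (C x) := rfl
  simp only [unitE, expE, tE, hC]
  simp only [← map_mul, ← map_add, ← map_pow, ← map_one (Ideal.Quotient.mk _)]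
  rw [Ideal.Quotient.eq, Ideal.mem_span_singleton]
  refine ⟨C a * C 2⁻¹ * (2 * C b * C c + C c ^ 2 * X), ?_⟩
  simp only [map_mul, map_add, map_pow]
  ring

open Polynomial in
/-- The coefficientwise content of an equation `1 - u = v` between exponentials. -/
theorem coeff_eq_of_one_sub_unitE_eq {K : Type*} [Field K] {a b c a' b' c' : K}
    (h : 1 - unitE a b c = unitE a' b' c') :
    a' = 1 - a ∧ a' * b' = -(a * b) ∧
      a' * (c' + 2⁻¹ * b' ^ 2) = -(a * (c + 2⁻¹ * b ^ 2)) := by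
  rw [unitE_eq_mk, unitE_eq_mk, ← map_one (Ideal.Quotient.mk _), ← map_sub,
    Ideal.Quotient.eq, Ideal.mem_span_singleton, X_pow_dvd_iff] at h
  have h0 := h 0 (by norm_num)
  have h1 := h 1 (by norm_num)
  have h2 := h 2 (by norm_num)
  simp only [coeff_sub, coeff_add, coeff_C_mul, coeff_C, coeff_X, coeff_X_pow, coeff_one]
    at h0 h1 h2
  norm_num at h0 h1 h2
  refine ⟨?_, ?_, ?_⟩
  · linear_combination -h0
  · linear_combination -h1
  · linear_combination -h2

theorem lsDeriv_one_sub {F : Type*} [Field F] (f : LaurentSeries F) :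
    lsDeriv (1 - f) = -lsDeriv f := by
  ext n
  by_cases hn : n + 1 = 0
  · have hn' : (n : F) + 1 = 0 := by exact_mod_cast congrArg (Int.cast : ℤ → F) hn
    simp [lsDeriv, hn']
  · simp [lsDeriv, HahnSeries.coeff_one, hn]

/-- `Omega` is a determinant, so it vanishes when the data of the first two entries are
proportional. -/
theorem Omega_eq_zero_of_proportional {K : Type*} [Field K] (D : K → K) (a0 a1 x2 y2 : Fin 3 → K)
    (r : K) (h1 : a1 0 = r * a1 1) (h2 : x2 0 - y2 0 = r * (x2 1 - y2 1))
    (hD : D (a0 0) / a0 0 = r * (D (a0 1) / a0 1)) : Omega D a0 a1 x2 y2 = 0 := by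
  have hdet : Omega D a0 a1 x2 y2 =
      (Matrix.of fun i j => ![a1 i, D (a0 i) / a0 i, x2 i - y2 i] j).det := by
    rw [Matrix.det_apply, Omega]
    refine Finset.sum_congr rfl fun σ _ => ?_
    simp only [Fin.prod_univ_three, Matrix.of_apply, Units.smul_def]
    congr 1
    simp
    ring
  rw [hdet, Matrix.det_fin_three]
  simp [h1, h2, hD]
  ring

/-- Let `k` be a field of characteristic `0`, `k'` a finite extension of
`k`, and `K = k'((s))`.  Let `f̃, f̂` be units of `K[t]/(t³)` such that `1 − f̃` and `1 − f̂`
are also units and `f̃ ≡ f̂ mod t²`, and let `g̃, ĝ` be units of `K[t]/(t³)` with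
`g̃ ≡ ĝ mod t²`.  (The congruences are encoded by the shared exponential parameters: `f̃, f̂`
have parameters `(a0f, a1f, x2f)` resp. `(a0f, a1f, y2f)` with `a0f ≠ 0`; `1 − f̃, 1 − f̂`
have parameters `(b0, b1, xb2)` resp. `(b0, b1, yb2)` with `b0 ≠ 0`; and `g̃, ĝ` have
parameters `(c0, c1, xc2)` resp. `(c0, c1, yc2)` with `c0 ≠ 0`.)  Then
`Ω((1 − f̃, f̃, g̃), (1 − f̂, f̂, ĝ)) = 0`.  Consequently, the canonical 1-form `ω` vanishes
on the image of the relative Bloch complex map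
`Δ : B₂(B,(t²)) ⊗ β(B,(t²)) → Λ³β(B,(t²))` for `B = K[[t]]`. -/
theorem statement_10 {k : Type*} [Field k] [CharZero k] {k' : Type*} [Field k']
    [Algebra k k'] [FiniteDimensional k k']
    (tf hf tg hg : T3 (LaurentSeries k'))
    (a0f a1f x2f y2f b0 b1 xb2 yb2 c0 c1 xc2 yc2 : LaurentSeries k')
    (ha0f : a0f ≠ 0) (hb0 : b0 ≠ 0) (hc0 : c0 ≠ 0)
    (htf : tf = unitE a0f a1f x2f) (hhf : hf = unitE a0f a1f y2f)
    (htf1 : 1 - tf = unitE b0 b1 xb2) (hhf1 : 1 - hf = unitE b0 b1 yb2)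
    (htg : tg = unitE c0 c1 xc2) (hhg : hg = unitE c0 c1 yc2) :
    Omega lsDeriv ![b0, a0f, c0] ![b1, a1f, c1] ![xb2, x2f, xc2] ![yb2, y2f, yc2] = 0 := by
  subst htf hhf
  obtain ⟨e0, e1, e2⟩ := coeff_eq_of_one_sub_unitE_eq htf1
  obtain ⟨-, -, e2'⟩ := coeff_eq_of_one_sub_unitE_eq hhf1
  have hD : lsDeriv b0 = -lsDeriv a0f := by rw [e0, lsDeriv_one_sub]
  refine Omega_eq_zero_of_proportional _ _ _ _ _ (-(a0f / b0)) ?_ ?_ ?_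
  · simp only [Matrix.cons_val_zero, Matrix.cons_val_one]
    field_simp
    linear_combination e1
  · simp only [Matrix.cons_val_zero, Matrix.cons_val_one]
    field_simp
    linear_combination e2 - e2'
  · simp only [Matrix.cons_val_zero, Matrix.cons_val_one, hD]
    field_simp

end
end
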